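/- arXiv:math/0612452 — 2 statements merged into one kernel-verified Lean document; each statement's English description precedes it below -/
import Mathlib

section
/- For any function f in the homogeneous Sobolev space Ḣ^{1/2}(ℝⁿ) with n ≥ 3, the weighted integral |∫_{ℝⁿ} f(x) (x/|x|)·∇f(x) dx| is bounded by a constant times ‖f‖²_{Ḣ^{1/2}(ℝⁿ)}. -/
open MeasureTheory
open scoped FourierTransform

section Aux
open SchwartzMap
variable {n : ℕ} {G : Type*} [NormedAddCommGroup G] [NormedSpace ℝ G]

lemma aux_tg (s r : ℝ) : (fun x : EuclideanSpace ℝ (Fin n) => (1 + ‖s • x‖ ^ 2) ^ r).HasTemperateGrowth := by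
  have h1 := Function.hasTemperateGrowth_one_add_norm_sq_rpow (H := EuclideanSpace ℝ (Fin n)) r
  have h2 : (fun x : EuclideanSpace ℝ (Fin n) => s • x).HasTemperateGrowth :=
    (s • ContinuousLinearMap.id ℝ (EuclideanSpace ℝ (Fin n))).hasTemperateGrowth
  exact h1.comp h2

lemma aux_coord (x : EuclideanSpace ℝ (Fin n)) (L : EuclideanSpace ℝ (Fin n) →L[ℝ] G) :
    L x = ∑ i, x i • L (EuclideanSpace.single i 1) := by
  conv_lhs => rw [← (EuclideanSpace.basisFun (Fin n) ℝ).sum_repr x]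
  simp

lemma aux_rad (F : SchwartzMap (EuclideanSpace ℝ (Fin n)) G) :
    ∃ R : SchwartzMap (EuclideanSpace ℝ (Fin n)) G, ∀ x, R x = fderiv ℝ F x x := by
  refine ⟨∑ i, SchwartzMap.smulLeftCLM G (fun x : EuclideanSpace ℝ (Fin n) => x i)
      (LineDeriv.lineDerivOp (EuclideanSpace.single i (1:ℝ)) F), fun x => ?_⟩
  rw [aux_coord x (fderiv ℝ F x), sum_apply]
  refine Finset.sum_congr rfl fun i _ => ?_
  rw [SchwartzMap.smulLeftCLM_apply_apply]
  · rfl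
  · exact (EuclideanSpace.proj (𝕜 := ℝ) i).hasTemperateGrowth

lemma aux_euler (F : SchwartzMap (EuclideanSpace ℝ (Fin n)) G) :
    Integrable (fun x => fderiv ℝ F x x) ∧
    ∫ x, fderiv ℝ F x x = -((n : ℝ) • ∫ x, F x) := by
  have hi : ∀ i : Fin n, Integrable (fun x : EuclideanSpace ℝ (Fin n) =>
      x i • fderiv ℝ F x (EuclideanSpace.single i 1)) := by
    intro i
    have h := (SchwartzMap.smulLeftCLM G (fun x : EuclideanSpace ℝ (Fin n) => x i)
      (LineDeriv.lineDerivOp (EuclideanSpace.single i (1:ℝ)) F)).integrable (μ := volume)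
    rw [SchwartzMap.smulLeftCLM_apply] at h
    · exact h
    · exact (EuclideanSpace.proj (𝕜 := ℝ) i).hasTemperateGrowth
  have hi2 : ∀ i : Fin n, Integrable (fun x : EuclideanSpace ℝ (Fin n) => x i • F x) := by
    intro i
    have h := (SchwartzMap.smulLeftCLM G (fun x : EuclideanSpace ℝ (Fin n) => x i) F).integrable (μ := volume)
    rw [SchwartzMap.smulLeftCLM_apply] at h
    · exact h
    · exact (EuclideanSpace.proj (𝕜 := ℝ) i).hasTemperateGrowth
  have key : ∀ i : Fin n, ∫ x : EuclideanSpace ℝ (Fin n),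
      x i • fderiv ℝ F x (EuclideanSpace.single i 1) = - ∫ x, F x := by
    intro i
    have hd : ∀ x : EuclideanSpace ℝ (Fin n), fderiv ℝ (fun x : EuclideanSpace ℝ (Fin n) => x i) x
        = EuclideanSpace.proj (𝕜 := ℝ) i :=
      fun x => (EuclideanSpace.proj (𝕜 := ℝ) i).fderiv
    rw [integral_smul_fderiv_eq_neg_fderiv_smul_of_integrable]
    · simp [hd]
    · simpa [hd] using F.integrable
    · exact hi i
    · exact hi2 i
    · intro x _; exact (EuclideanSpace.proj (𝕜 := ℝ) i).differentiableAt
    · exact fun x _ => F.differentiableAt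
  have e : (fun x => fderiv ℝ F x x) = fun x => ∑ i, x i • fderiv ℝ F x (EuclideanSpace.single i 1) := by
    ext x; exact aux_coord x _
  rw [e]
  refine ⟨integrable_finsetSum _ fun i _ => hi i, ?_⟩
  rw [integral_finsetSum _ fun i _ => hi i]
  simp [key, ← Nat.cast_smul_eq_nsmul ℝ]

lemma aux_wd (s r : ℝ) (x : EuclideanSpace ℝ (Fin n)) :
    fderiv ℝ (fun x : EuclideanSpace ℝ (Fin n) => (1 + ‖s • x‖ ^ 2) ^ r) x x =
      (1 + ‖s • x‖ ^ 2) ^ r * (2 * r * (‖s • x‖ ^ 2 / (1 + ‖s • x‖ ^ 2))) := by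
  have h0 : (0:ℝ) < 1 + ‖s • x‖ ^ 2 := by positivity
  have h1 : HasFDerivAt (fun x : EuclideanSpace ℝ (Fin n) => 1 + ‖s • x‖ ^ 2) _ x :=
    (((s • ContinuousLinearMap.id ℝ (EuclideanSpace ℝ (Fin n))).hasFDerivAt (x := x)).norm_sq).const_add 1
  have h2 := (h1.rpow_const (p := r) (Or.inl h0.ne')).fderiv
  rw [h2, Real.rpow_sub_one h0.ne']
  simp [norm_smul]
  field_simp
  rw [sq_abs]; ring

lemma aux_ibp (s r : ℝ) (h : SchwartzMap (EuclideanSpace ℝ (Fin n)) G) :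
    ∫ x, (1 + ‖s • x‖ ^ 2) ^ r • fderiv ℝ h x x =
     - ∫ x, ((1 + ‖s • x‖ ^ 2) ^ r * (n + 2 * r * (‖s • x‖ ^ 2 / (1 + ‖s • x‖ ^ 2)))) • h x := by
  have tg := aux_tg (n := n) s r
  let F := SchwartzMap.smulLeftCLM G (fun x : EuclideanSpace ℝ (Fin n) => (1 + ‖s • x‖ ^ 2) ^ r) h
  have hF : (F : EuclideanSpace ℝ (Fin n) → G) = fun x => (1 + ‖s • x‖ ^ 2) ^ r • h x :=
    SchwartzMap.smulLeftCLM_apply tg h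
  obtain ⟨i1, e1⟩ := aux_euler F
  obtain ⟨i2, e2⟩ := aux_euler h
  have hd : ∀ x, fderiv ℝ F x x = (1 + ‖s • x‖ ^ 2) ^ r • fderiv ℝ h x x +
      ((1 + ‖s • x‖ ^ 2) ^ r * (2 * r * (‖s • x‖ ^ 2 / (1 + ‖s • x‖ ^ 2)))) • h x := by
    intro x
    rw [hF, fderiv_fun_smul (tg.1.differentiable (by simp) x) h.differentiableAt, ← aux_wd]
    simp
  have i3 : Integrable (fun x => (1 + ‖s • x‖ ^ 2) ^ r • fderiv ℝ h x x) := by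
    obtain ⟨R, hR⟩ := aux_rad h
    have := (SchwartzMap.smulLeftCLM G (fun x : EuclideanSpace ℝ (Fin n) => (1 + ‖s • x‖ ^ 2) ^ r) R).integrable (μ := volume)
    rw [SchwartzMap.smulLeftCLM_apply tg] at this
    simpa [hR] using this
  have i4 : Integrable (fun x => F x) := F.integrable
  have e3 : ∀ x, (1 + ‖s • x‖ ^ 2) ^ r • fderiv ℝ h x x = fderiv ℝ F x x -
      ((1 + ‖s • x‖ ^ 2) ^ r * (2 * r * (‖s • x‖ ^ 2 / (1 + ‖s • x‖ ^ 2)))) • h x := by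
    intro x; rw [hd]; abel
  have i5 : Integrable (fun x =>  ((1 + ‖s • x‖ ^ 2) ^ r * (2 * r * (‖s • x‖ ^ 2 / (1 + ‖s • x‖ ^ 2)))) • h x) := by
    convert i1.sub i3 using 1
    ext x; simp [hd]
  simp_rw [e3]
  rw [integral_sub i1 i5, e1, ← integral_smul, ← integral_neg, ← integral_sub, ← integral_neg]
  · congr 1; ext x; rw [hF]; simp only [smul_smul, mul_add, add_smul]; rw [mul_comm]; abel
  · exact (i4.smul (n:ℝ)).neg
  · exact i5

lemma aux_int (s r : ℝ) (f : SchwartzMap (EuclideanSpace ℝ (Fin n)) ℂ) :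
    Integrable (fun x => (1 + ‖s • x‖ ^ 2) ^ r * ‖f x‖ ^ 2) := by
  have := (SchwartzMap.smulLeftCLM ℝ (fun x : EuclideanSpace ℝ (Fin n) => (1 + ‖s • x‖ ^ 2) ^ r)
    (SchwartzMap.pairing (innerSL ℝ) f f)).integrable (μ := volume)
  rw [SchwartzMap.smulLeftCLM_apply (aux_tg s r)] at this
  refine this.congr (.of_forall fun x => ?_)
  simp only [SchwartzMap.pairing_apply_apply, smul_eq_mul]
  rw [← real_inner_self_eq_norm_sq (f x)]
  rfl

lemma aux_sqint (f : SchwartzMap (EuclideanSpace ℝ (Fin n)) G) :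
    Integrable (fun x => ‖f x‖ ^ 2) :=
  (f.memLp 2 volume).integrable_norm_pow (by norm_num)

lemma aux_opnorm (L : EuclideanSpace ℝ (Fin n) →L[ℝ] G) :
    ‖L‖ ^ 2 ≤ ∑ i, ‖L (EuclideanSpace.single i 1)‖ ^ 2 := by
  have : ‖L‖ ≤ √(∑ i, ‖L (EuclideanSpace.single i 1)‖ ^ 2) := by
    refine L.opNorm_le_bound (by positivity) fun x => ?_
    rw [aux_coord x L, EuclideanSpace.norm_eq, ← Real.sqrt_mul (by positivity)]
    refine Real.le_sqrt_of_sq_le ?_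
    calc _ ≤ (∑ i, ‖L (EuclideanSpace.single i 1)‖ * ‖x i‖) ^ 2 := by
          gcongr
          refine (norm_sum_le _ _).trans (Finset.sum_le_sum fun i _ => ?_)
          rw [norm_smul, mul_comm]
      _ ≤ _ := Finset.sum_mul_sq_le_sq_mul_sq _ _ _
  calc _ ≤ √(∑ i, ‖L (EuclideanSpace.single i 1)‖ ^ 2) ^ 2 := by gcongr
    _ = _ := Real.sq_sqrt (by positivity)

lemma aux_grad (g : SchwartzMap (EuclideanSpace ℝ (Fin n)) ℂ) :
    ∫ x, ‖fderiv ℝ g x‖ ^ 2 ≤ (2 * Real.pi) ^ 2 * ∫ ξ, ‖ξ‖ ^ 2 * ‖𝓕 g ξ‖ ^ 2 := by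
  have h1 : ∀ i : Fin n, Integrable fun x => ‖fderiv ℝ g x (EuclideanSpace.single i 1)‖ ^ 2 :=
    fun i => aux_sqint (LineDeriv.lineDerivOp (EuclideanSpace.single i (1:ℝ)) g)
  have hF : ∀ (i : Fin n) ξ, ‖𝓕 (LineDeriv.lineDerivOp (EuclideanSpace.single i (1:ℝ)) g) ξ‖ ^ 2 =
      (2 * Real.pi) ^ 2 * (‖ξ i‖ ^ 2 * ‖𝓕 g ξ‖ ^ 2) := by
    intro i ξ
    rw [SchwartzMap.fourier_lineDerivOp_eq, smul_apply, SchwartzMap.smulLeftCLM_apply_apply]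
    · simp [mul_pow, EuclideanSpace.inner_single_right]
    · exact Function.hasTemperateGrowth_inner_left _
  have h2 : ∀ i : Fin n, Integrable fun ξ => (2 * Real.pi) ^ 2 * (‖ξ i‖ ^ 2 * ‖𝓕 g ξ‖ ^ 2) := by
    intro i
    simp_rw [← hF]
    exact aux_sqint _
  calc ∫ x, ‖fderiv ℝ g x‖ ^ 2 ≤ ∫ x, ∑ i, ‖fderiv ℝ g x (EuclideanSpace.single i 1)‖ ^ 2 := by
        refine integral_mono (aux_sqint (SchwartzMap.fderivCLM ℝ _ _ g)) ?_ fun x => aux_opnorm _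
        exact integrable_finsetSum _ fun i _ => h1 i
    _ = ∑ i, ∫ x, ‖fderiv ℝ g x (EuclideanSpace.single i 1)‖ ^ 2 :=
        integral_finsetSum _ fun i _ => h1 i
    _ = ∑ i, ∫ ξ, (2 * Real.pi) ^ 2 * (‖ξ i‖ ^ 2 * ‖𝓕 g ξ‖ ^ 2) := by
        refine Finset.sum_congr rfl fun i _ => ?_
        simp_rw [← hF]
        exact (SchwartzMap.integral_norm_sq_fourier
          (LineDeriv.lineDerivOp (EuclideanSpace.single i (1:ℝ)) g)).symm
    _ = _ := by
        rw [← integral_finsetSum _ fun i _ => h2 i, ← integral_const_mul]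
        congr 1; ext ξ
        rw [← Finset.mul_sum, ← Finset.sum_mul, EuclideanSpace.norm_sq_eq]

lemma aux_hardy (hn : 3 ≤ n) (s : ℝ) (g : SchwartzMap (EuclideanSpace ℝ (Fin n)) ℂ) :
    s ^ 2 * ∫ x, (1 + ‖s • x‖ ^ 2) ^ (-1 : ℝ) * ‖g x‖ ^ 2 ≤ 4 * ∫ x, ‖fderiv ℝ g x‖ ^ 2 := by
  have hn' : (3:ℝ) ≤ n := by exact_mod_cast hn
  let h : SchwartzMap (EuclideanSpace ℝ (Fin n)) ℝ := SchwartzMap.pairing (innerSL ℝ) g g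
  have hh : (h : EuclideanSpace ℝ (Fin n) → ℝ) = fun x => inner ℝ (g x) (g x) := by
    rfl
  have hd : ∀ x, fderiv ℝ h x x = 2 * inner ℝ (g x) (fderiv ℝ g x x) := by
    intro x
    rw [hh, fderiv_inner_apply ℝ g.differentiableAt g.differentiableAt, real_inner_comm]
    rw [real_inner_comm]; ring
  have ibp := aux_ibp s (-1) h
  have iw := aux_int s (-1) g
  have iD : Integrable (fun x => ‖fderiv ℝ g x‖ ^ 2) := aux_sqint (SchwartzMap.fderivCLM ℝ _ _ g)
  obtain ⟨R, hR⟩ := aux_rad h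
  have iR : Integrable (fun x => (1 + ‖s • x‖ ^ 2) ^ (-1 : ℝ) • fderiv ℝ h x x) := by
    have := (SchwartzMap.smulLeftCLM ℝ (fun x : EuclideanSpace ℝ (Fin n) => (1 + ‖s • x‖ ^ 2) ^ (-1:ℝ)) R).integrable (μ := volume)
    rw [SchwartzMap.smulLeftCLM_apply (aux_tg s _)] at this
    simpa only [hR] using this
  have ith : ∀ x : EuclideanSpace ℝ (Fin n), 0 ≤ ‖s • x‖ ^ 2 / (1 + ‖s • x‖ ^ 2) ∧ ‖s • x‖ ^ 2 / (1 + ‖s • x‖ ^ 2) ≤ 1 := by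
    intro x
    exact ⟨by positivity, by rw [div_le_one (by positivity)]; linarith⟩
  have cth : Continuous (fun x : EuclideanSpace ℝ (Fin n) => (‖s • x‖ ^ 2 / (1 + ‖s • x‖ ^ 2))) := by
    refine Continuous.div (by fun_prop) (by fun_prop) fun x => by positivity
  have iL : Integrable (fun x => ((1 + ‖s • x‖ ^ 2) ^ (-1 : ℝ) * (n + 2 * (-1) * (‖s • x‖ ^ 2 / (1 + ‖s • x‖ ^ 2)))) • h x) := by
    have : Integrable (fun x : EuclideanSpace ℝ (Fin n) => (n + 2 * (-1) * (‖s • x‖ ^ 2 / (1 + ‖s • x‖ ^ 2))) * ((1 + ‖s • x‖ ^ 2) ^ (-1 : ℝ) * ‖g x‖ ^ 2)) := by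
      refine iw.bdd_mul (c := n + 2) (Continuous.aestronglyMeasurable (by fun_prop)) (.of_forall fun x => ?_)
      rw [Real.norm_eq_abs, abs_le]
      constructor <;> linarith [(ith x).1, (ith x).2]
    refine this.congr (.of_forall fun x => ?_)
    simp only [hh, real_inner_self_eq_norm_sq, smul_eq_mul]; ring
  have k1 : ∫ x, (1 + ‖s • x‖ ^ 2) ^ (-1 : ℝ) * ‖g x‖ ^ 2 ≤ ∫ x, ((1 + ‖s • x‖ ^ 2) ^ (-1 : ℝ) * (n + 2 * (-1) * (‖s • x‖ ^ 2 / (1 + ‖s • x‖ ^ 2)))) • h x := by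
    refine integral_mono iw iL fun x => ?_
    simp only [hh, real_inner_self_eq_norm_sq, smul_eq_mul]
    have : 0 ≤ (1 + ‖s • x‖ ^ 2) ^ (-1 : ℝ) := by positivity
    gcongr
    refine le_mul_of_one_le_right this ?_
    linarith [(ith x).2]
  have k2 : s ^ 2 * (- ∫ x, (1 + ‖s • x‖ ^ 2) ^ (-1 : ℝ) • fderiv ℝ h x x) ≤
      ∫ x, ((1 / 2) * s ^ 2 * ((1 + ‖s • x‖ ^ 2) ^ (-1 : ℝ) * ‖g x‖ ^ 2) + 2 * ‖fderiv ℝ g x‖ ^ 2) := by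
    rw [← integral_neg, ← integral_const_mul]
    refine integral_mono (iR.neg.const_mul _) ((iw.const_mul _).add (iD.const_mul _)) fun x => ?_
    simp only [hd, smul_eq_mul]
    have b1 : -inner ℝ (g x) (fderiv ℝ g x x) ≤ ‖g x‖ * (‖fderiv ℝ g x‖ * ‖x‖) := by
      refine (neg_le_abs _).trans ((abs_real_inner_le_norm _ _).trans ?_)
      gcongr
      exact (fderiv ℝ g x).le_opNorm x
    rw [Real.rpow_neg_one]
    have hp : 0 < 1 + ‖s • x‖ ^ 2 := by positivity
    have hns : ‖s • x‖ ^ 2 = s ^ 2 * ‖x‖ ^ 2 := by rw [norm_smul, mul_pow, Real.norm_eq_abs, sq_abs]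
    rw [hns] at hp ⊢
    have e : s ^ 2 * -((1 + s ^ 2 * ‖x‖ ^ 2)⁻¹ * (2 * inner ℝ (g x) (fderiv ℝ g x x))) =
      (2 * s ^ 2 * (-inner ℝ (g x) (fderiv ℝ g x x))) / (1 + s ^ 2 * ‖x‖ ^ 2) := by
      field_simp
    rw [e, div_le_iff₀ hp]
    have e2 : (1 / 2 * s ^ 2 * ((1 + s ^ 2 * ‖x‖ ^ 2)⁻¹ * ‖g x‖ ^ 2) + 2 * ‖fderiv ℝ g x‖ ^ 2) * (1 + s ^ 2 * ‖x‖ ^ 2)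
      = 1 / 2 * s ^ 2 * ‖g x‖ ^ 2 + 2 * ‖fderiv ℝ g x‖ ^ 2 * (1 + s ^ 2 * ‖x‖ ^ 2) := by
      field_simp
    rw [e2]
    have b2 := mul_le_mul_of_nonneg_left b1 (by positivity : 0 ≤ 2 * s ^ 2)
    nlinarith [mul_nonneg (sq_nonneg s) (sq_nonneg (‖g x‖ - 2 * (‖fderiv ℝ g x‖ * ‖x‖))), sq_nonneg ‖fderiv ℝ g x‖]
  rw [integral_add (iw.const_mul _) (iD.const_mul _), integral_const_mul, integral_const_mul, ibp, neg_neg] at k2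
  have k3 := mul_le_mul_of_nonneg_left k1 (sq_nonneg s)
  linarith

lemma aux_pers (hn : 3 ≤ n) (s : ℝ) (hs : s ≠ 0) (f : SchwartzMap (EuclideanSpace ℝ (Fin n)) ℂ) :
    ∫ x, (1 + ‖s • x‖ ^ 2) ^ (-1 : ℝ) * ‖f x‖ ^ 2 ≤
      (2 + 32 * Real.pi ^ 2) * ∫ ξ, (‖ξ‖ ^ 2 / (s ^ 2 + ‖ξ‖ ^ 2)) * ‖𝓕 f ξ‖ ^ 2 := by
  have tg := aux_tg (n := n) s⁻¹ (-1)
  let u : SchwartzMap (EuclideanSpace ℝ (Fin n)) ℂ :=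
    SchwartzMap.smulLeftCLM ℂ (fun x : EuclideanSpace ℝ (Fin n) => (1 + ‖s⁻¹ • x‖ ^ 2) ^ (-1 : ℝ)) (𝓕 f)
  have hu : ∀ ξ, u ξ = ((s ^ 2 / (s ^ 2 + ‖ξ‖ ^ 2) : ℝ) : ℂ) * 𝓕 f ξ := by
    intro ξ
    rw [SchwartzMap.smulLeftCLM_apply_apply tg, Complex.real_smul, Real.rpow_neg_one, norm_smul, mul_pow,
      norm_inv, Real.norm_eq_abs, inv_pow, sq_abs]
    congr 2
    field_simp
  let lo : SchwartzMap (EuclideanSpace ℝ (Fin n)) ℂ := 𝓕⁻ u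
  have hlo : 𝓕 lo = u := FourierTransform.fourier_fourierInv_eq u
  let hi : SchwartzMap (EuclideanSpace ℝ (Fin n)) ℂ := f - lo
  have hhi : 𝓕 hi = 𝓕 f - u := by
    rw [← hlo]; exact map_sub (FourierTransform.fourierCLM ℂ (SchwartzMap (EuclideanSpace ℝ (Fin n)) ℂ)) f lo
  have hpos : ∀ ξ : EuclideanSpace ℝ (Fin n), 0 < s ^ 2 + ‖ξ‖ ^ 2 := fun ξ => by positivity
  have hhi' : ∀ ξ, ‖𝓕 hi ξ‖ ^ 2 ≤ (‖ξ‖ ^ 2 / (s ^ 2 + ‖ξ‖ ^ 2)) * ‖𝓕 f ξ‖ ^ 2 := by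
    intro ξ
    have : 𝓕 hi ξ = ((‖ξ‖ ^ 2 / (s ^ 2 + ‖ξ‖ ^ 2) : ℝ) : ℂ) * 𝓕 f ξ := by
      rw [hhi, sub_apply, hu]
      have : ‖ξ‖ ^ 2 / (s ^ 2 + ‖ξ‖ ^ 2) = 1 - s ^ 2 / (s ^ 2 + ‖ξ‖ ^ 2) := by
        have := (hpos ξ).ne'
        field_simp; ring
      rw [this]; push_cast; ring
    rw [this, norm_mul, mul_pow, Complex.norm_real, Real.norm_of_nonneg (by positivity)]
    gcongr
    refine pow_le_of_le_one (by positivity) ?_ two_ne_zero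
    rw [div_le_one (hpos ξ)]; nlinarith
  have hlo' : ∀ ξ, ‖ξ‖ ^ 2 * ‖𝓕 lo ξ‖ ^ 2 ≤ s ^ 2 * ((‖ξ‖ ^ 2 / (s ^ 2 + ‖ξ‖ ^ 2)) * ‖𝓕 f ξ‖ ^ 2) := by
    intro ξ
    rw [hlo, hu, norm_mul, mul_pow, Complex.norm_real, Real.norm_of_nonneg (by positivity), ← mul_assoc,
      ← mul_assoc]
    refine mul_le_mul_of_nonneg_right ?_ (by positivity)
    have h1 : s ^ 2 / (s ^ 2 + ‖ξ‖ ^ 2) ≤ 1 := by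
      rw [div_le_one (hpos ξ)]; nlinarith [sq_nonneg ‖ξ‖]
    have h2 : 0 ≤ s ^ 2 / (s ^ 2 + ‖ξ‖ ^ 2) := by positivity
    calc _ ≤ ‖ξ‖ ^ 2 * (s ^ 2 / (s ^ 2 + ‖ξ‖ ^ 2)) := by
          gcongr
          exact pow_le_of_le_one h2 h1 two_ne_zero
      _ = _ := by ring
  have iM : Integrable (fun ξ => (‖ξ‖ ^ 2 / (s ^ 2 + ‖ξ‖ ^ 2)) * ‖𝓕 f ξ‖ ^ 2) := by
    refine (aux_sqint (𝓕 f)).bdd_mul (c := 1) (Continuous.aestronglyMeasurable ?_) (.of_forall fun x => ?_)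
    · exact Continuous.div (by fun_prop) (by fun_prop) fun x => (hpos x).ne'
    · rw [Real.norm_of_nonneg (by positivity), div_le_one (hpos x)]; nlinarith
  have iG : Integrable (fun ξ => ‖ξ‖ ^ 2 * ‖𝓕 lo ξ‖ ^ 2) := by
    refine (iM.const_mul (s ^ 2)).mono' (Continuous.aestronglyMeasurable ?_) (.of_forall fun x => ?_)
    · have := (𝓕 lo).continuous
      fun_prop
    · rw [Real.norm_of_nonneg (by positivity)]; exact hlo' x
  have c1 : ∫ x, ‖hi x‖ ^ 2 ≤ ∫ ξ, (‖ξ‖ ^ 2 / (s ^ 2 + ‖ξ‖ ^ 2)) * ‖𝓕 f ξ‖ ^ 2 := by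
    rw [← SchwartzMap.integral_norm_sq_fourier]
    exact integral_mono (aux_sqint _) iM hhi'
  have c2 : ∫ ξ, ‖ξ‖ ^ 2 * ‖𝓕 lo ξ‖ ^ 2 ≤ s ^ 2 * ∫ ξ, (‖ξ‖ ^ 2 / (s ^ 2 + ‖ξ‖ ^ 2)) * ‖𝓕 f ξ‖ ^ 2 := by
    rw [← integral_const_mul]
    exact integral_mono iG (iM.const_mul _) hlo'
  have c3 : ∫ x, (1 + ‖s • x‖ ^ 2) ^ (-1 : ℝ) * ‖lo x‖ ^ 2 ≤
      16 * Real.pi ^ 2 * ∫ ξ, (‖ξ‖ ^ 2 / (s ^ 2 + ‖ξ‖ ^ 2)) * ‖𝓕 f ξ‖ ^ 2 := by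
    have h1 := aux_hardy hn s lo
    have h2 := aux_grad lo
    have h3 := mul_le_mul_of_nonneg_left c2 (by positivity : 0 ≤ 16 * Real.pi ^ 2)
    have h4 : s ^ 2 * ∫ x, (1 + ‖s • x‖ ^ 2) ^ (-1 : ℝ) * ‖lo x‖ ^ 2 ≤
      s ^ 2 * (16 * Real.pi ^ 2 * ∫ ξ, (‖ξ‖ ^ 2 / (s ^ 2 + ‖ξ‖ ^ 2)) * ‖𝓕 f ξ‖ ^ 2) := by linarith
    exact le_of_mul_le_mul_left h4 (by positivity)
  have c4 : ∫ x, (1 + ‖s • x‖ ^ 2) ^ (-1 : ℝ) * ‖f x‖ ^ 2 ≤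
      ∫ x, (2 * ‖hi x‖ ^ 2 + 2 * ((1 + ‖s • x‖ ^ 2) ^ (-1 : ℝ) * ‖lo x‖ ^ 2)) := by
    refine integral_mono (aux_int s _ f) (((aux_sqint hi).const_mul _).add ((aux_int s _ lo).const_mul _))
      fun x => ?_
    have hf : f x = hi x + lo x := by simp [hi]
    have w0 : 0 ≤ (1 + ‖s • x‖ ^ 2) ^ (-1 : ℝ) := by positivity
    have w1 : (1 + ‖s • x‖ ^ 2) ^ (-1 : ℝ) ≤ 1 := by
      rw [Real.rpow_neg_one]
      exact inv_le_one_of_one_le₀ (by nlinarith [sq_nonneg ‖s • x‖])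
    have t : ‖f x‖ ^ 2 ≤ 2 * ‖hi x‖ ^ 2 + 2 * ‖lo x‖ ^ 2 := by
      have : ‖f x‖ ≤ ‖hi x‖ + ‖lo x‖ := by rw [hf]; exact norm_add_le _ _
      nlinarith [sq_nonneg (‖hi x‖ - ‖lo x‖), norm_nonneg (f x)]
    have t1 := mul_le_mul_of_nonneg_left t w0
    have t2 := mul_le_mul_of_nonneg_right w1 (by positivity : 0 ≤ 2 * ‖hi x‖ ^ 2)
    simp only
    linarith
  rw [integral_add ((aux_sqint hi).const_mul _) ((aux_int s _ lo).const_mul _), integral_const_mul,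
    integral_const_mul] at c4
  linarith

lemma aux_J (a : ℝ) (ha : 0 < a) :
    ∫⁻ s : ℝ, ENNReal.ofReal ((1 + (s * a) ^ 2)⁻¹) = ENNReal.ofReal (Real.pi / a) := by
  rw [← ofReal_integral_eq_lintegral_ofReal]
  · congr 1
    have := Measure.integral_comp_mul_right (fun s : ℝ => (1 + s ^ 2)⁻¹) a
    rw [this, integral_univ_inv_one_add_sq, abs_of_pos (inv_pos.2 ha), smul_eq_mul]; ring
  · exact integrable_inv_one_add_sq.comp_mul_right' ha.ne'
  · exact .of_forall fun s => by positivity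

lemma aux_kato (hn : 3 ≤ n) (f : SchwartzMap (EuclideanSpace ℝ (Fin n)) ℂ) :
    ∫⁻ x, ENNReal.ofReal (‖x‖⁻¹ * ‖f x‖ ^ 2) ≤
      ENNReal.ofReal ((2 + 32 * Real.pi ^ 2) * ∫ ξ, ‖ξ‖ * ‖𝓕 f ξ‖ ^ 2) := by
  have : Nonempty (Fin n) := ⟨⟨0, by omega⟩⟩
  have hne : ∀ᵐ x : EuclideanSpace ℝ (Fin n), x ≠ 0 := by
    simp [ae_iff]
  have hpi := Real.pi_pos
  have hK : (0:ℝ) ≤ 2 + 32 * Real.pi ^ 2 := by positivity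
  have L : ∫⁻ s : ℝ, ∫⁻ x, ENNReal.ofReal ((1 + (s * ‖x‖) ^ 2)⁻¹ * ‖f x‖ ^ 2) =
      ENNReal.ofReal Real.pi * ∫⁻ x, ENNReal.ofReal (‖x‖⁻¹ * ‖f x‖ ^ 2) := by
    rw [lintegral_lintegral_swap, ← lintegral_const_mul']
    · refine lintegral_congr_ae (hne.mono fun x hx => ?_)
      have hx' : 0 < ‖x‖ := norm_pos_iff.2 hx
      simp only
      rw [← ENNReal.ofReal_mul hpi.le, ← mul_assoc, ENNReal.ofReal_mul (by positivity), ← div_eq_mul_inv, ← aux_J _ hx',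
        ← lintegral_mul_const']
      · refine lintegral_congr fun s => ?_
        rw [ENNReal.ofReal_mul (by positivity)]
      · exact ENNReal.ofReal_ne_top
    · exact ENNReal.ofReal_ne_top
    · have := f.continuous
      refine Measurable.aemeasurable ?_
      fun_prop
  have Rr : ∫⁻ s : ℝ, ∫⁻ ξ, ENNReal.ofReal ((‖ξ‖ ^ 2 / (s ^ 2 + ‖ξ‖ ^ 2)) * ‖𝓕 f ξ‖ ^ 2) =
      ENNReal.ofReal Real.pi * ∫⁻ ξ, ENNReal.ofReal (‖ξ‖ * ‖𝓕 f ξ‖ ^ 2) := by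
    rw [lintegral_lintegral_swap, ← lintegral_const_mul']
    · refine lintegral_congr_ae (hne.mono fun x hx => ?_)
      have hx' : 0 < ‖x‖ := norm_pos_iff.2 hx
      have hJ := aux_J _ (inv_pos.2 hx')
      rw [div_inv_eq_mul] at hJ
      simp only
      rw [← ENNReal.ofReal_mul hpi.le, ← mul_assoc, ENNReal.ofReal_mul (by positivity), ← hJ,
        ← lintegral_mul_const']
      · refine lintegral_congr fun s => ?_
        rw [ENNReal.ofReal_mul (by positivity)]
        congr 2
        have : 0 < s ^ 2 + ‖x‖ ^ 2 := by positivity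
        field_simp
        ring
      · exact ENNReal.ofReal_ne_top
    · exact ENNReal.ofReal_ne_top
    · have := (𝓕 f).continuous
      refine Measurable.aemeasurable ?_
      fun_prop
  have M : ∫⁻ s : ℝ, ∫⁻ x, ENNReal.ofReal ((1 + (s * ‖x‖) ^ 2)⁻¹ * ‖f x‖ ^ 2) ≤
      ∫⁻ s : ℝ, ENNReal.ofReal (2 + 32 * Real.pi ^ 2) *
        ∫⁻ ξ, ENNReal.ofReal ((‖ξ‖ ^ 2 / (s ^ 2 + ‖ξ‖ ^ 2)) * ‖𝓕 f ξ‖ ^ 2) := by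
    have h0 : ∀ᵐ s : ℝ, s ≠ 0 := by simp [ae_iff]
    refine lintegral_mono_ae (h0.mono fun s hs => ?_)
    have e : ∀ x : EuclideanSpace ℝ (Fin n), (1 + (s * ‖x‖) ^ 2)⁻¹ * ‖f x‖ ^ 2 =
        (1 + ‖s • x‖ ^ 2) ^ (-1 : ℝ) * ‖f x‖ ^ 2 := by
      intro x
      rw [Real.rpow_neg_one, norm_smul, mul_pow, mul_pow, Real.norm_eq_abs, sq_abs]
    have iM : Integrable (fun ξ => (‖ξ‖ ^ 2 / (s ^ 2 + ‖ξ‖ ^ 2)) * ‖𝓕 f ξ‖ ^ 2) := by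
      refine (aux_sqint (𝓕 f)).bdd_mul (c := 1) (Continuous.aestronglyMeasurable ?_) (.of_forall fun x => ?_)
      · exact Continuous.div (by fun_prop) (by fun_prop) fun x => by positivity
      · rw [Real.norm_of_nonneg (by positivity), div_le_one (by positivity)]; nlinarith
    simp only [e]
    rw [← ofReal_integral_eq_lintegral_ofReal (aux_int s _ f) (.of_forall fun x => by positivity),
      ← ofReal_integral_eq_lintegral_ofReal iM (.of_forall fun x => by positivity),
      ← ENNReal.ofReal_mul hK]
    exact ENNReal.ofReal_le_ofReal (aux_pers hn s hs f)
  rw [lintegral_const_mul' _ _ ENNReal.ofReal_ne_top, L, Rr, mul_left_comm] at M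
  have M' := (ENNReal.mul_le_mul_iff_right (by simpa using hpi) ENNReal.ofReal_ne_top).1 M
  rw [ENNReal.ofReal_mul hK, ofReal_integral_eq_lintegral_ofReal]
  · exact M'
  · have h1 := aux_sqint (𝓕 f)
    have h2 := aux_int 1 1 (𝓕 f)
    refine h2.mono' ?_ (.of_forall fun x => ?_)
    · have := (𝓕 f).continuous
      exact Continuous.aestronglyMeasurable (by fun_prop)
    · rw [Real.norm_of_nonneg (by positivity), one_smul, Real.rpow_one]
      gcongr
      nlinarith [sq_nonneg (‖x‖ - 1)]
  · exact .of_forall fun x => by positivity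

lemma aux_reg (hn : 3 ≤ n) (s : ℝ) (hs : 0 < s) (f : SchwartzMap (EuclideanSpace ℝ (Fin n)) ℂ) :
    ‖∫ x, f x * fderiv ℝ f x ((s * (1 + ‖s • x‖ ^ 2) ^ (-(1/2) : ℝ)) • x)‖ ≤
      n * (2 + 32 * Real.pi ^ 2) * ∫ ξ, ‖ξ‖ * ‖𝓕 f ξ‖ ^ 2 := by
  let h : SchwartzMap (EuclideanSpace ℝ (Fin n)) ℂ := SchwartzMap.pairing (ContinuousLinearMap.mul ℝ ℂ) f f
  have hh : (h : EuclideanSpace ℝ (Fin n) → ℂ) = fun x => f x * f x := rfl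
  have hd : ∀ x, fderiv ℝ h x x = 2 * (f x * fderiv ℝ f x x) := by
    intro x
    rw [hh, fderiv_fun_mul f.differentiableAt f.differentiableAt]
    simp; ring
  have ibp := aux_ibp s (-(1/2)) h
  have iw := aux_int s (-(1/2)) f
  have e1 : ∫ x, f x * fderiv ℝ f x ((s * (1 + ‖s • x‖ ^ 2) ^ (-(1/2) : ℝ)) • x) =
      ((s / 2 : ℝ) : ℂ) * ∫ x, (1 + ‖s • x‖ ^ 2) ^ (-(1/2) : ℝ) • fderiv ℝ h x x := by
    rw [← integral_const_mul]
    congr 1; ext x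
    rw [hd, map_smul, Complex.real_smul, Complex.real_smul]; push_cast; ring
  have hI : 0 ≤ ∫ ξ, ‖ξ‖ * ‖𝓕 f ξ‖ ^ 2 := integral_nonneg fun ξ => by positivity
  have e2 : s * ∫ x, (1 + ‖s • x‖ ^ 2) ^ (-(1/2) : ℝ) * ‖f x‖ ^ 2 ≤
      (2 + 32 * Real.pi ^ 2) * ∫ ξ, ‖ξ‖ * ‖𝓕 f ξ‖ ^ 2 := by
    have : Nonempty (Fin n) := ⟨⟨0, by omega⟩⟩
    have hne : ∀ᵐ x : EuclideanSpace ℝ (Fin n), x ≠ 0 := by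
      simp [ae_iff]
    rw [← integral_const_mul, ← ENNReal.ofReal_le_ofReal_iff (by positivity),
      ofReal_integral_eq_lintegral_ofReal (iw.const_mul s) (.of_forall fun x => by positivity)]
    refine le_trans (lintegral_mono_ae (hne.mono fun x hx => ?_)) (aux_kato hn f)
    have hx' : 0 < ‖x‖ := norm_pos_iff.2 hx
    apply ENNReal.ofReal_le_ofReal
    rw [← mul_assoc]
    gcongr
    rw [Real.rpow_neg (by positivity), ← Real.sqrt_eq_rpow, ← div_eq_mul_inv, div_le_iff₀ (by positivity),
      ← div_eq_inv_mul, le_div_iff₀ hx']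
    apply Real.le_sqrt_of_sq_le
    rw [norm_smul, Real.norm_of_nonneg hs.le]; linarith
  rw [e1, ibp, norm_mul, norm_neg, Complex.norm_real, Real.norm_of_nonneg (by positivity)]
  have e3 : ‖∫ x, ((1 + ‖s • x‖ ^ 2) ^ (-(1/2) : ℝ) * (n + 2 * (-(1/2)) * (‖s • x‖ ^ 2 / (1 + ‖s • x‖ ^ 2)))) • h x‖ ≤
      ∫ x, n * ((1 + ‖s • x‖ ^ 2) ^ (-(1/2) : ℝ) * ‖f x‖ ^ 2) := by
    refine norm_integral_le_of_norm_le (iw.const_mul _) (.of_forall fun x => ?_)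
    have hn' : (3:ℝ) ≤ n := by exact_mod_cast hn
    have t0 : 0 ≤ ‖s • x‖ ^ 2 / (1 + ‖s • x‖ ^ 2) := by positivity
    have t1 : ‖s • x‖ ^ 2 / (1 + ‖s • x‖ ^ 2) ≤ 1 := by rw [div_le_one (by positivity)]; linarith
    rw [norm_smul, norm_mul, Real.norm_of_nonneg (by positivity : 0 ≤ (1 + ‖s • x‖ ^ 2) ^ (-(1/2) : ℝ)),
      Real.norm_of_nonneg (by linarith), hh, norm_mul, ← sq, ← mul_assoc, mul_comm (n : ℝ)]
    gcongr
    linarith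
  rw [integral_const_mul] at e3
  have hnn : (0:ℝ) ≤ n := by positivity
  have e4 := mul_le_mul_of_nonneg_left e2 hnn
  have e5 := mul_le_mul_of_nonneg_left e3 (by positivity : 0 ≤ s / 2)
  have : 0 ≤ (2 + 32 * Real.pi ^ 2) * ∫ ξ, ‖ξ‖ * ‖𝓕 f ξ‖ ^ 2 := by positivity
  have := mul_nonneg hnn this
  linarith
end Aux

/-- For `f` in `Ḣ^{1/2}(ℝⁿ)`, `n ≥ 3` (modeled as a Schwartz function),
`|∫ f(x) (x/|x|)·∇f(x) dx| ≲ ‖f‖²_{Ḣ^{1/2}}`, with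
`‖f‖²_{Ḣ^{1/2}} = ∫ |ξ| ‖𝓕f(ξ)‖² dξ`. -/
theorem stmt0 (n : ℕ) (hn : 3 ≤ n) :
    ∃ C > 0, ∀ f : SchwartzMap (EuclideanSpace ℝ (Fin n)) ℂ,
      ‖∫ x : EuclideanSpace ℝ (Fin n), f x * fderiv ℝ (⇑f) x ((‖x‖)⁻¹ • x)‖ ≤
        C * ∫ ξ : EuclideanSpace ℝ (Fin n), ‖ξ‖ * ‖𝓕 (⇑f) ξ‖ ^ 2 := by
  have hn0 : 0 < n := by omega
  refine ⟨n * (2 + 32 * Real.pi ^ 2), by positivity, fun f => ?_⟩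
  have lim : Filter.Tendsto (fun k : ℕ => ∫ x, f x * fderiv ℝ f x
      ((((k:ℝ) + 1) * (1 + ‖((k:ℝ) + 1) • x‖ ^ 2) ^ (-(1/2) : ℝ)) • x)) Filter.atTop
      (nhds (∫ x, f x * fderiv ℝ (⇑f) x ((‖x‖)⁻¹ • x))) := by
    have cD : Continuous (fderiv ℝ f) := (SchwartzMap.fderivCLM ℝ _ _ f).continuous
    have cf := f.continuous
    refine tendsto_integral_of_dominated_convergence (fun x => ‖f x‖ * ‖fderiv ℝ f x‖) ?_ ?_ ?_ ?_
    · intro k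
      have cw : Continuous fun x : EuclideanSpace ℝ (Fin n) => (1 + ‖((k:ℝ) + 1) • x‖ ^ 2) ^ (-(1/2) : ℝ) :=
        Continuous.rpow_const (by fun_prop) fun x => Or.inl (by positivity)
      exact Continuous.aestronglyMeasurable (by fun_prop)
    · have h1 := aux_sqint f
      have h2 := aux_sqint (SchwartzMap.fderivCLM ℝ _ _ f)
      refine (h1.add h2).mono' (Continuous.aestronglyMeasurable (by fun_prop)) (.of_forall fun x => ?_)
      rw [Real.norm_of_nonneg (by positivity)]
      simp only [Pi.add_apply, SchwartzMap.fderivCLM_apply]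
      nlinarith [sq_nonneg (‖f x‖ - ‖fderiv ℝ f x‖), sq_nonneg (‖f x‖ + ‖fderiv ℝ f x‖)]
    · refine fun k => .of_forall fun x => ?_
      rw [norm_mul]
      gcongr
      refine ((fderiv ℝ f x).le_opNorm _).trans (mul_le_of_le_one_right (norm_nonneg _) ?_)
      have hk : (0:ℝ) < (k:ℝ) + 1 := by positivity
      rw [norm_smul, Real.norm_of_nonneg (by positivity), Real.rpow_neg (by positivity), ← Real.sqrt_eq_rpow,
        mul_right_comm, ← div_eq_mul_inv, div_le_one (by positivity)]
      apply Real.le_sqrt_of_sq_le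
      rw [norm_smul, Real.norm_of_nonneg hk.le]; linarith
    · refine .of_forall fun x => ?_
      by_cases hx : x = 0
      · simp [hx]
      have hx' : 0 < ‖x‖ := norm_pos_iff.2 hx
      refine Filter.Tendsto.const_mul _ (((fderiv ℝ f x).continuous.tendsto _).comp (Filter.Tendsto.smul_const ?_ x))
      have a1 : Filter.Tendsto (fun k : ℕ => 1 / ((k:ℝ) + 1)) Filter.atTop (nhds 0) :=
        tendsto_one_div_add_atTop_nhds_zero_nat
      have a2 : Filter.Tendsto (fun k : ℕ => (√((1 / ((k:ℝ) + 1)) ^ 2 + ‖x‖ ^ 2))⁻¹) Filter.atTop (nhds ((√(0 ^ 2 + ‖x‖ ^ 2))⁻¹)) := by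
        refine Filter.Tendsto.inv₀ (((a1.pow 2).add_const _).sqrt) (by positivity)
      have a3 : (√(0 ^ 2 + ‖x‖ ^ 2))⁻¹ = ‖x‖⁻¹ := by simp
      rw [a3] at a2
      refine a2.congr fun k => ?_
      have hk : (0:ℝ) < (k:ℝ) + 1 := by positivity
      rw [Real.rpow_neg (by positivity), ← Real.sqrt_eq_rpow]
      have : 1 + ‖((k:ℝ) + 1) • x‖ ^ 2 = ((k:ℝ) + 1) ^ 2 * ((1 / ((k:ℝ) + 1)) ^ 2 + ‖x‖ ^ 2) := by
        rw [norm_smul, Real.norm_of_nonneg hk.le]; field_simp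
      rw [this, Real.sqrt_mul (by positivity), Real.sqrt_sq hk.le, mul_inv, mul_inv_cancel_left₀ hk.ne']
  refine le_of_tendsto lim.norm (.of_forall fun k => ?_)
  exact aux_reg hn _ (by positivity) f
end

section
/- The operator T(f)(x) := (x/|x|) f(x) (multiplication by the unit vector x/|x|) is bounded on the homogeneous Sobolev space Ḣ^{1/2}(ℝⁿ) for n ≥ 3. -/
open MeasureTheory
open scoped FourierTransform SchwartzMap LineDeriv

namespace HalfSob

variable {n : ℕ}

/-- Regularized `1/|x|`. -/
noncomputable def R (a : ℝ) (x : EuclideanSpace ℝ (Fin n)) : ℝ := a * (1 + ‖a • x‖ ^ 2) ^ (-(1/2) : ℝ)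

lemma R_nonneg {a : ℝ} (ha : 0 < a) (x : EuclideanSpace ℝ (Fin n)) : 0 ≤ R a x := by
  unfold R; positivity

lemma R_sq {a : ℝ} (ha : 0 < a) (x : EuclideanSpace ℝ (Fin n)) :
    R a x ^ 2 * (1 / a ^ 2 + ‖x‖ ^ 2) = 1 := by
  unfold R
  have h : (0:ℝ) < 1 + ‖a • x‖ ^ 2 := by positivity
  rw [mul_pow, ← Real.rpow_natCast (_ ^ (-(1/2) : ℝ)), ← Real.rpow_mul h.le]
  norm_num
  rw [Real.rpow_neg_one, norm_smul, Real.norm_of_nonneg ha.le, mul_pow]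
  have : (0:ℝ) < 1 + a ^ 2 * ‖x‖ ^ 2 := by positivity
  field_simp

lemma R_sq_le {a : ℝ} (ha : 0 < a) (x : EuclideanSpace ℝ (Fin n)) :
    R a x ^ 2 * ‖x‖ ^ 2 ≤ 1 := by
  have := R_sq ha x
  have h2 : 0 ≤ R a x ^ 2 * (1 / a ^ 2) := by positivity
  linarith

lemma sq_coord_le (x : EuclideanSpace ℝ (Fin n)) (i : Fin n) : x i ^ 2 ≤ ‖x‖ ^ 2 := by
  rw [EuclideanSpace.real_norm_sq_eq]
  exact Finset.single_le_sum (f := fun i => x i ^ 2) (fun i _ => sq_nonneg _) (Finset.mem_univ i)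

lemma R_temp (a : ℝ) : (R a : EuclideanSpace ℝ (Fin n) → ℝ).HasTemperateGrowth := by
  unfold R
  have h := (Function.hasTemperateGrowth_one_add_norm_sq_rpow (EuclideanSpace ℝ (Fin n)) (-(1/2))).comp
    (a • ContinuousLinearMap.id ℝ (EuclideanSpace ℝ (Fin n))).hasTemperateGrowth
  exact (Function.HasTemperateGrowth.const a).mul h

lemma R_deriv {a : ℝ} (ha : 0 < a) (x : EuclideanSpace ℝ (Fin n)) :
    HasFDerivAt (R a) (-(R a x ^ 3) • innerSL ℝ x) x := by
  have h : (0:ℝ) < 1 + ‖a • x‖ ^ 2 := by positivity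
  have h1 : HasFDerivAt (fun y : EuclideanSpace ℝ (Fin n) => 1 + ‖a • y‖ ^ 2)
      ((2 * a ^ 2) • innerSL ℝ x) x := by
    have h2 : (fun y : EuclideanSpace ℝ (Fin n) => 1 + ‖a • y‖ ^ 2) = fun y => 1 + a ^ 2 * ‖y‖ ^ 2 := by
      ext y; rw [norm_smul, mul_pow, Real.norm_eq_abs, sq_abs]
    rw [h2]
    refine (((hasStrictFDerivAt_norm_sq x).hasFDerivAt.const_mul (a ^ 2)).const_add 1).congr_fderiv ?_
    ext v; simp; ring
  have h3 := (h1.rpow_const (p := (-(1/2) : ℝ)) (Or.inl h.ne')).const_mul a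
  unfold R
  refine h3.congr_fderiv ?_
  rw [smul_smul, smul_smul]
  congr 1
  rw [mul_pow, ← Real.rpow_natCast (_ ^ (-(1/2) : ℝ)), ← Real.rpow_mul h.le]
  norm_num
  ring

lemma coord_temp (i : Fin n) : (fun x : EuclideanSpace ℝ (Fin n) => x i).HasTemperateGrowth :=
  (EuclideanSpace.proj (𝕜 := ℝ) i : EuclideanSpace ℝ (Fin n) →L[ℝ] ℝ).hasTemperateGrowth

lemma m_temp (a : ℝ) (i : Fin n) :
    (fun x : EuclideanSpace ℝ (Fin n) => x i * R a x).HasTemperateGrowth :=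
  (coord_temp i).mul (R_temp a)

lemma g_temp (a : ℝ) (i : Fin n) :
    (fun x : EuclideanSpace ℝ (Fin n) => x i * R a x ^ 2).HasTemperateGrowth :=
  (coord_temp i).mul ((R_temp a).pow 2)

lemma coord_deriv (x : EuclideanSpace ℝ (Fin n)) (i : Fin n) :
    HasFDerivAt (fun x : EuclideanSpace ℝ (Fin n) => x i)
      (EuclideanSpace.proj (𝕜 := ℝ) i : EuclideanSpace ℝ (Fin n) →L[ℝ] ℝ) x :=
  (EuclideanSpace.proj (𝕜 := ℝ) i : EuclideanSpace ℝ (Fin n) →L[ℝ] ℝ).hasFDerivAt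

noncomputable abbrev e (j : Fin n) : EuclideanSpace ℝ (Fin n) := EuclideanSpace.single j 1

/-- Partial derivative of a Schwartz function. -/
noncomputable abbrev dd (j : Fin n) (h : 𝓢(EuclideanSpace ℝ (Fin n), ℂ)) :
    𝓢(EuclideanSpace ℝ (Fin n), ℂ) := ∂_{e j} h

lemma deriv_g {a : ℝ} (ha : 0 < a) (h : 𝓢(EuclideanSpace ℝ (Fin n), ℂ)) (j : Fin n)
    (x : EuclideanSpace ℝ (Fin n)) :
    dd j (SchwartzMap.smulLeftCLM ℂ (fun x : EuclideanSpace ℝ (Fin n) => x j * R a x ^ 2) h) x =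
      (x j * R a x ^ 2) • dd j h x + (R a x ^ 2 - 2 * x j ^ 2 * R a x ^ 4) • h x := by
  rw [SchwartzMap.lineDerivOp_apply_eq_fderiv, SchwartzMap.lineDerivOp_apply_eq_fderiv,
    SchwartzMap.smulLeftCLM_apply (g_temp a j)]
  have h1 := ((coord_deriv x j).mul ((R_deriv ha x).pow 2)).smul (h.differentiableAt (x := x)).hasFDerivAt
  have h2 := h1.fderiv
  erw [h2]
  simp [EuclideanSpace.inner_single_right]
  ring_nf
  simp

lemma deriv_m {a : ℝ} (ha : 0 < a) (h : 𝓢(EuclideanSpace ℝ (Fin n), ℂ)) (i j : Fin n)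
    (x : EuclideanSpace ℝ (Fin n)) :
    dd j (SchwartzMap.smulLeftCLM ℂ (fun x : EuclideanSpace ℝ (Fin n) => x i * R a x) h) x =
      (x i * R a x) • dd j h x + ((e j) i * R a x - x i * x j * R a x ^ 3) • h x := by
  rw [SchwartzMap.lineDerivOp_apply_eq_fderiv, SchwartzMap.lineDerivOp_apply_eq_fderiv,
    SchwartzMap.smulLeftCLM_apply (m_temp a i)]
  have h1 := ((coord_deriv x i).mul (R_deriv ha x)).smul (h.differentiableAt (x := x)).hasFDerivAt
  have h2 := h1.fderiv
  erw [h2]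
  simp [EuclideanSpace.inner_single_right]
  ring_nf
  simp

lemma int_sq (h : 𝓢(EuclideanSpace ℝ (Fin n), ℂ)) : Integrable (fun x => ‖h x‖ ^ 2) :=
  (h.memLp 2).integrable_norm_pow (by norm_num)

lemma hardy (hn : 3 ≤ n) {a : ℝ} (ha : 0 < a) (h : 𝓢(EuclideanSpace ℝ (Fin n), ℂ)) :
    ∫ x, R a x ^ 2 * ‖h x‖ ^ 2 ≤ 4 * ∑ j, ∫ x, ‖dd j h x‖ ^ 2 := by
  set g : Fin n → 𝓢(EuclideanSpace ℝ (Fin n), ℂ) := fun j =>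
    SchwartzMap.smulLeftCLM ℂ (fun x : EuclideanSpace ℝ (Fin n) => x j * R a x ^ 2) h with hg
  have hi : Integrable (fun x => R a x ^ 2 * ‖h x‖ ^ 2) := by
    convert int_sq (SchwartzMap.smulLeftCLM ℂ (R a) h) using 2 with x
    rw [SchwartzMap.smulLeftCLM_apply_apply (R_temp a), norm_smul, mul_pow, Real.norm_eq_abs, sq_abs]
  have hin : ∀ u v : 𝓢(EuclideanSpace ℝ (Fin n), ℂ), Integrable (fun x => inner ℝ (u x) (v x)) :=
    fun u v => (SchwartzMap.bilinLeftCLM (innerSL ℝ (E := ℂ)) v.hasTemperateGrowth u).integrable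
  have hin2 : ∀ j, Integrable (fun x => inner ℝ (h x) (dd j (g j) x) + inner ℝ (dd j h x) (g j x)) :=
    fun j => (hin h _).add (hin _ _)
  have h0 : ∀ j, ∫ x, (inner ℝ (h x) (dd j (g j) x) + inner ℝ (dd j h x) (g j x)) = 0 := by
    intro j
    rw [integral_add (hin h _) (hin _ _)]
    have := SchwartzMap.integral_bilinear_lineDerivOp_right_eq_neg_left (μ := volume) h (g j)
      (innerSL ℝ (E := ℂ)) (e j)
    change ∫ x, inner ℝ (h x) (dd j (g j) x) = -∫ x, inner ℝ (dd j h x) (g j x) at this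
    rw [this]; simp
  have h1 : ∫ x, ∑ j, (inner ℝ (h x) (dd j (g j) x) + inner ℝ (dd j h x) (g j x)) = 0 := by
    rw [integral_finsetSum _ fun j _ => (hin2 j)]
    exact Finset.sum_eq_zero fun j _ => h0 j
  have h2 : ∀ x, (1/2) * (R a x ^ 2 * ‖h x‖ ^ 2) - 2 * ∑ j, ‖dd j h x‖ ^ 2 ≤
      ∑ j, (inner ℝ (h x) (dd j (g j) x) + inner ℝ (dd j h x) (g j x)) := by
    intro x
    have key : ∀ j, (R a x ^ 2 - 5 / 2 * x j ^ 2 * R a x ^ 4) * ‖h x‖ ^ 2 - 2 * ‖dd j h x‖ ^ 2 ≤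
        inner ℝ (h x) (dd j (g j) x) + inner ℝ (dd j h x) (g j x) := by
      intro j
      rw [hg]
      simp only
      rw [deriv_g ha, SchwartzMap.smulLeftCLM_apply_apply (g_temp a j), inner_add_right,
        inner_smul_right, inner_smul_right, inner_smul_right, real_inner_self_eq_norm_sq,
        real_inner_comm (h x) (dd j h x)]
      have hc := abs_le.1 (abs_real_inner_le_norm (h x) (dd j h x))
      set I : ℝ := inner ℝ (h x) (dd j h x)
      have hI : I ^ 2 ≤ (‖h x‖ * ‖dd j h x‖) ^ 2 := sq_le_sq' hc.1 hc.2
      set s := x j * R a x ^ 2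
      have hs : x j ^ 2 * R a x ^ 4 = s ^ 2 := by ring
      have : -(2 * s * I) ≤ 1 / 2 * s ^ 2 * ‖h x‖ ^ 2 + 2 * ‖dd j h x‖ ^ 2 := by
        have h5 : |2 * s * I| ≤ 2 * |s| * (‖h x‖ * ‖dd j h x‖) := by
          rw [abs_mul, abs_mul, abs_two]
          gcongr
          exact abs_real_inner_le_norm _ _
        have h6 := neg_abs_le (2 * s * I)
        have h7 := sq_nonneg (|s| * ‖h x‖ - 2 * ‖dd j h x‖)
        have h8 : |s| ^ 2 = s ^ 2 := sq_abs s
        nlinarith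
      simp only [mul_assoc] at *
      nlinarith
    refine le_trans ?_ (Finset.sum_le_sum fun j _ => key j)
    rw [Finset.sum_sub_distrib, ← Finset.sum_mul, Finset.sum_sub_distrib, ← Finset.mul_sum]
    simp only [Finset.sum_const, Finset.card_univ, Fintype.card_fin, nsmul_eq_mul]
    rw [← Finset.sum_mul, ← Finset.mul_sum, ← EuclideanSpace.real_norm_sq_eq]
    have hn' : (3:ℝ) ≤ n := by exact_mod_cast hn
    have h3 := R_sq_le ha x
    have h4 : 1 / 2 * R a x ^ 2 ≤ n * R a x ^ 2 - 5 / 2 * ‖x‖ ^ 2 * R a x ^ 4 := by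
      have h5 : R a x ^ 2 * ‖x‖ ^ 2 * R a x ^ 2 ≤ 1 * R a x ^ 2 := by gcongr
      have h6 : 3 * R a x ^ 2 ≤ n * R a x ^ 2 := by gcongr
      nlinarith
    have h5 : 1 / 2 * R a x ^ 2 * ‖h x‖ ^ 2 ≤ (n * R a x ^ 2 - 5 / 2 * ‖x‖ ^ 2 * R a x ^ 4) * ‖h x‖ ^ 2 := by
      gcongr
    linarith
  have hs : Integrable (fun x => ∑ j, ‖dd j h x‖ ^ 2) :=
    integrable_finsetSum _ fun j _ => int_sq _
  have h3 := integral_mono ((hi.const_mul (1/2)).sub (hs.const_mul 2))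
    (integrable_finsetSum _ fun j _ => hin2 j) h2
  have h4 : ∫ x, ((1/2) * (R a x ^ 2 * ‖h x‖ ^ 2) - 2 * ∑ j, ‖dd j h x‖ ^ 2) ≤ 0 := by
    refine h3.trans (le_of_eq ?_)
    exact h1
  rw [integral_sub (hi.const_mul (1/2)) (hs.const_mul 2), integral_const_mul, integral_const_mul,
    integral_finsetSum _ fun j _ => int_sq _] at h4
  linarith

lemma grad (hn : 3 ≤ n) {a : ℝ} (ha : 0 < a) (h : 𝓢(EuclideanSpace ℝ (Fin n), ℂ)) (i : Fin n) :
    ∑ j, ∫ x, ‖dd j (SchwartzMap.smulLeftCLM ℂ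
      (fun x : EuclideanSpace ℝ (Fin n) => x i * R a x) h) x‖ ^ 2
      ≤ (2 + 32 * n) * ∑ j, ∫ x, ‖dd j h x‖ ^ 2 := by
  have hi : Integrable (fun x => R a x ^ 2 * ‖h x‖ ^ 2) := by
    convert int_sq (SchwartzMap.smulLeftCLM ℂ (R a) h) using 2 with x
    rw [SchwartzMap.smulLeftCLM_apply_apply (R_temp a), norm_smul, mul_pow, Real.norm_eq_abs, sq_abs]
  have h1 : ∀ j, ∫ x, ‖dd j (SchwartzMap.smulLeftCLM ℂ
      (fun x : EuclideanSpace ℝ (Fin n) => x i * R a x) h) x‖ ^ 2 ≤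
      (2 * ∫ x, ‖dd j h x‖ ^ 2) + 32 * ∑ j, ∫ x, ‖dd j h x‖ ^ 2 := by
    intro j
    have : ∫ x, ‖dd j (SchwartzMap.smulLeftCLM ℂ
      (fun x : EuclideanSpace ℝ (Fin n) => x i * R a x) h) x‖ ^ 2 ≤
      ∫ x, (2 * ‖dd j h x‖ ^ 2 + 8 * (R a x ^ 2 * ‖h x‖ ^ 2)) := by
      refine integral_mono (int_sq _) (((int_sq _).const_mul 2).add (hi.const_mul 8)) fun x => ?_
      simp only
      rw [deriv_m ha]
      have b1 : |x i * R a x| ≤ 1 := by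
        rw [← sq_le_one_iff_abs_le_one, mul_pow]
        have := R_sq_le ha x
        have := mul_le_mul_of_nonneg_right (sq_coord_le x i) (sq_nonneg (R a x))
        linarith
      have b1' : |x j * R a x| ≤ 1 := by
        rw [← sq_le_one_iff_abs_le_one, mul_pow]
        have := R_sq_le ha x
        have := mul_le_mul_of_nonneg_right (sq_coord_le x j) (sq_nonneg (R a x))
        linarith
      have hR := R_nonneg ha x
      have b2 : |(e j) i * R a x - x i * x j * R a x ^ 3| ≤ 2 * R a x := by
        have e1 : x i * x j * R a x ^ 3 = (x i * R a x) * (x j * R a x) * R a x := by ring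
        rw [e1, ← sub_mul, abs_mul, abs_of_nonneg hR]
        gcongr
        refine (abs_sub _ _).trans ?_
        have e2 : |(e j) i| ≤ 1 := by
          simp [e]; split_ifs <;> simp
        have e3 : |x i * R a x * (x j * R a x)| ≤ 1 := by
          rw [abs_mul]; exact mul_le_one₀ b1 (abs_nonneg _) b1'
        linarith
      have b3 : ‖(x i * R a x) • dd j h x + ((e j) i * R a x - x i * x j * R a x ^ 3) • h x‖ ≤
          1 * ‖dd j h x‖ + 2 * R a x * ‖h x‖ := by
        refine (norm_add_le _ _).trans ?_
        rw [norm_smul, norm_smul, Real.norm_eq_abs, Real.norm_eq_abs]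
        gcongr
      calc _ ≤ (1 * ‖dd j h x‖ + 2 * R a x * ‖h x‖) ^ 2 := by gcongr
        _ ≤ _ := by nlinarith [sq_nonneg (‖dd j h x‖ - 2 * R a x * ‖h x‖)]
    rw [integral_add ((int_sq _).const_mul 2) (hi.const_mul 8), integral_const_mul,
      integral_const_mul] at this
    have := hardy hn ha h
    linarith
  refine (Finset.sum_le_sum fun j _ => h1 j).trans (le_of_eq ?_)
  rw [Finset.sum_add_distrib, ← Finset.mul_sum, Finset.sum_const]
  simp
  ring

lemma planch (h : 𝓢(EuclideanSpace ℝ (Fin n), ℂ)) :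
    ∑ j, ∫ x, ‖dd j h x‖ ^ 2 = (2 * Real.pi) ^ 2 * ∫ ξ, ‖ξ‖ ^ 2 * ‖𝓕 h ξ‖ ^ 2 := by
  have hc : ∀ j ξ, ‖𝓕 (dd j h) ξ‖ ^ 2 = (2 * Real.pi) ^ 2 * (ξ j ^ 2 * ‖𝓕 h ξ‖ ^ 2) := by
    intro j ξ
    have : (inner ℝ · (e j : EuclideanSpace ℝ (Fin n))).HasTemperateGrowth :=
      Function.hasTemperateGrowth_inner_left _
    rw [SchwartzMap.fourier_lineDerivOp_eq, smul_apply,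
      SchwartzMap.smulLeftCLM_apply_apply this, norm_smul, norm_smul]
    simp [EuclideanSpace.inner_single_right, mul_pow, abs_of_pos Real.pi_pos]
  simp_rw [← SchwartzMap.integral_norm_sq_fourier (dd _ h), hc, integral_const_mul]
  rw [← Finset.mul_sum, ← integral_finsetSum]
  · simp_rw [← Finset.sum_mul, ← EuclideanSpace.real_norm_sq_eq]
  · intro j _
    have := int_sq (𝓕 (dd j h))
    simp_rw [hc] at this
    have h2 := this.const_mul ((2 * Real.pi) ^ 2)⁻¹
    simpa [Real.pi_ne_zero] using h2

lemma h1bound (hn : 3 ≤ n) {a : ℝ} (ha : 0 < a) (h : 𝓢(EuclideanSpace ℝ (Fin n), ℂ)) (i : Fin n) :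
    ∫ ξ, ‖ξ‖ ^ 2 * ‖𝓕 (SchwartzMap.smulLeftCLM ℂ
      (fun x : EuclideanSpace ℝ (Fin n) => x i * R a x) h) ξ‖ ^ 2
      ≤ (2 + 32 * n) * ∫ ξ, ‖ξ‖ ^ 2 * ‖𝓕 h ξ‖ ^ 2 := by
  have := grad hn ha h i
  rw [planch, planch, mul_left_comm] at this
  exact le_of_mul_le_mul_left this (by positivity)

lemma l2bound {a : ℝ} (ha : 0 < a) (h : 𝓢(EuclideanSpace ℝ (Fin n), ℂ)) (i : Fin n) :
    ∫ ξ, ‖𝓕 (SchwartzMap.smulLeftCLM ℂ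
      (fun x : EuclideanSpace ℝ (Fin n) => x i * R a x) h) ξ‖ ^ 2 ≤ ∫ ξ, ‖𝓕 h ξ‖ ^ 2 := by
  rw [SchwartzMap.integral_norm_sq_fourier, SchwartzMap.integral_norm_sq_fourier]
  refine integral_mono (int_sq _) (int_sq _) fun x => ?_
  simp only
  rw [SchwartzMap.smulLeftCLM_apply_apply (m_temp a i), norm_smul, mul_pow, Real.norm_eq_abs, sq_abs,
    mul_pow]
  have := R_sq_le ha x
  have := mul_le_mul_of_nonneg_right (sq_coord_le x i) (sq_nonneg (R a x))
  exact mul_le_of_le_one_left (by positivity) (by linarith)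

end HalfSob
namespace HalfSob

variable {n : ℕ}

open Set

lemma int_norm_sq (k : ℕ) (h : 𝓢(EuclideanSpace ℝ (Fin n), ℂ)) :
    Integrable (fun ξ => ‖ξ‖ ^ k * ‖h ξ‖ ^ 2) := by
  obtain ⟨C, hC0, hC⟩ := h.decay 0 0
  refine ((h.integrable_pow_mul volume k).const_mul C).mono' ?_ ?_
  · exact ((continuous_norm.pow k).mul (h.continuous.norm.pow 2)).aestronglyMeasurable
  · refine Filter.Eventually.of_forall fun x => ?_
    have := hC x
    simp only [pow_zero, one_mul, norm_iteratedFDeriv_zero] at this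
    rw [Real.norm_of_nonneg (by positivity)]
    calc ‖x‖ ^ k * ‖h x‖ ^ 2 = ‖h x‖ * (‖x‖ ^ k * ‖h x‖) := by ring
      _ ≤ C * (‖x‖ ^ k * ‖h x‖) := by gcongr

/-- The kernel in the layer-cake decomposition. -/
noncomputable def K (A t r : ℝ) : ℝ :=
  (if t ≤ r then 2 else 0) + (if r ≤ 2 * t then 2 * A * (t ^ 2)⁻¹ * r ^ 2 else 0)

lemma K_meas (A : ℝ) : Measurable (fun p : ℝ × ℝ => K A p.1 p.2) := by
  unfold K
  refine Measurable.add ?_ ?_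
  · exact Measurable.ite (measurableSet_le measurable_fst measurable_snd) (by fun_prop) (by fun_prop)
  · exact Measurable.ite (measurableSet_le measurable_snd (by fun_prop)) (by fun_prop) (by fun_prop)

lemma K_nonneg {A : ℝ} (hA : 0 ≤ A) (t r : ℝ) : 0 ≤ K A t r := by
  unfold K
  refine add_nonneg ?_ ?_ <;> split_ifs <;> positivity

lemma K_int {A : ℝ} (hA : 0 ≤ A) {r : ℝ} (hr : 0 ≤ r) :
    ∫⁻ t in Ioi (0:ℝ), ENNReal.ofReal (K A t r) ≤ ENNReal.ofReal ((2 + 4 * A) * r) := by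
  have h1 : ∫⁻ t in Ioi (0:ℝ), ENNReal.ofReal (if t ≤ r then 2 else 0) = ENNReal.ofReal (2 * r) := by
    have : ∀ t, ENNReal.ofReal (if t ≤ r then 2 else 0) = (Iic r).indicator (fun _ => (2 : ENNReal)) t := by
      intro t; by_cases h : t ≤ r <;> simp [h]
    simp_rw [this]
    rw [lintegral_indicator measurableSet_Iic, Measure.restrict_restrict measurableSet_Iic]
    rw [Iic_inter_Ioi]
    simp [ENNReal.ofReal_mul]
  have h2 : ∫⁻ t in Ioi (0:ℝ), ENNReal.ofReal (if r ≤ 2 * t then 2 * A * (t ^ 2)⁻¹ * r ^ 2 else 0) ≤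
      ENNReal.ofReal (4 * A * r) := by
    rcases hr.eq_or_lt with rfl | hr
    · simp
    have : ∀ t, ENNReal.ofReal (if r ≤ 2 * t then 2 * A * (t ^ 2)⁻¹ * r ^ 2 else 0) =
        (Ici (r / 2)).indicator (fun t => ENNReal.ofReal (2 * A * r ^ 2 * (t ^ 2)⁻¹)) t := by
      intro t
      by_cases h : r ≤ 2 * t
      · have h' : r / 2 ≤ t := by linarith
        simp only [h, if_true, indicator, mem_Ici, h']
        congr 1; ring
      · have h' : ¬ r / 2 ≤ t := by intro h'; apply h; linarith
        simp [h, h']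
    simp_rw [this]
    rw [lintegral_indicator measurableSet_Ici, Measure.restrict_restrict measurableSet_Ici]
    have e1 : Ici (r / 2) ∩ Ioi (0:ℝ) = Ici (r / 2) :=
      inter_eq_left.2 fun t ht => lt_of_lt_of_le (half_pos hr) ht
    rw [e1, setLIntegral_congr Ioi_ae_eq_Ici.symm]
    have hc : 0 < r / 2 := by positivity
    have hi : IntegrableOn (fun t : ℝ => 2 * A * r ^ 2 * t ^ (-2 : ℝ)) (Ioi (r / 2)) :=
      (integrableOn_Ioi_rpow_of_lt (by norm_num) hc).const_mul _
    have e2 : ∀ t ∈ Ioi (r / 2), 2 * A * r ^ 2 * (t ^ 2)⁻¹ = 2 * A * r ^ 2 * t ^ (-2 : ℝ) := by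
      intro t ht
      rw [Real.rpow_neg (hc.trans ht).le]
      norm_num
    rw [setLIntegral_congr_fun measurableSet_Ioi (fun t ht => congrArg ENNReal.ofReal (e2 t ht)),
      ← ofReal_integral_eq_lintegral_ofReal hi]
    · apply ENNReal.ofReal_le_ofReal
      rw [integral_const_mul, integral_Ioi_rpow_of_lt (by norm_num) hc]
      norm_num
      rw [Real.rpow_neg_one]
      apply le_of_eq
      field_simp
      ring
    · filter_upwards [ae_restrict_mem measurableSet_Ioi] with t ht
      have := hc.trans ht
      positivity
  calc _ = ∫⁻ t in Ioi (0:ℝ), (ENNReal.ofReal (if t ≤ r then 2 else 0) +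
        ENNReal.ofReal (if r ≤ 2 * t then 2 * A * (t ^ 2)⁻¹ * r ^ 2 else 0)) := by
        refine lintegral_congr fun t => ?_
        unfold K
        rw [ENNReal.ofReal_add] <;> split_ifs <;> positivity
    _ = _ := lintegral_add_left (by
        refine ENNReal.measurable_ofReal.comp ?_
        exact Measurable.ite measurableSet_Iic (by fun_prop) (by fun_prop)) _
    _ ≤ _ := add_le_add h1.le h2
    _ = _ := by rw [← ENNReal.ofReal_add (by positivity) (by positivity)]; congr 1; ring

lemma step {A : ℝ} (hA : 0 ≤ A)
    (T : 𝓢(EuclideanSpace ℝ (Fin n), ℂ) →L[ℝ] 𝓢(EuclideanSpace ℝ (Fin n), ℂ))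
    (h0 : ∀ h, ∫ ξ, ‖𝓕 (T h) ξ‖ ^ 2 ≤ ∫ ξ, ‖𝓕 h ξ‖ ^ 2)
    (h1 : ∀ h, ∫ ξ, ‖ξ‖ ^ 2 * ‖𝓕 (T h) ξ‖ ^ 2 ≤ A * ∫ ξ, ‖ξ‖ ^ 2 * ‖𝓕 h ξ‖ ^ 2)
    (f : 𝓢(EuclideanSpace ℝ (Fin n), ℂ)) {t : ℝ} (ht : 0 < t) :
    ∫⁻ ξ, ENNReal.ofReal (if t < ‖ξ‖ then ‖𝓕 (T f) ξ‖ ^ 2 else 0) ≤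
    ∫⁻ ξ, ENNReal.ofReal (K A t ‖ξ‖ * ‖𝓕 f ξ‖ ^ 2) := by
  let χ : ContDiffBump (0 : EuclideanSpace ℝ (Fin n)) := ⟨t, 2 * t, ht, by linarith⟩
  have hχ : (χ : EuclideanSpace ℝ (Fin n) → ℝ).HasTemperateGrowth :=
    χ.hasCompactSupport.hasTemperateGrowth χ.contDiff
  set h := SchwartzMap.fourierMultiplierCLM ℂ (χ : EuclideanSpace ℝ (Fin n) → ℝ) f with hh
  have hF : ∀ ξ, 𝓕 h ξ = χ ξ • 𝓕 f ξ := by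
    intro ξ
    rw [hh, SchwartzMap.fourierMultiplierCLM_apply, FourierTransform.fourier_fourierInv_eq,
      SchwartzMap.smulLeftCLM_apply_apply hχ]
  have hFk : ∀ ξ, 𝓕 (f - h) ξ = (1 - χ ξ) • 𝓕 f ξ := by
    intro ξ
    have : 𝓕 (f - h) = 𝓕 f - 𝓕 h := by
      exact map_sub (FourierTransform.fourierCLM ℂ 𝓢(EuclideanSpace ℝ (Fin n), ℂ)) f h
    rw [this, sub_apply, hF, sub_smul, one_smul]
  have hT : 𝓕 (T f) = 𝓕 (T (f - h)) + 𝓕 (T h) := by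
    rw [← FourierTransform.fourier_add, ← map_add, sub_add_cancel]
  have hin1 := int_sq (𝓕 (T (f - h)))
  have hin2 := int_norm_sq 2 (𝓕 (T h))
  have hin3 := int_sq (𝓕 (f - h))
  have hin4 := int_norm_sq 2 (𝓕 h)
  calc _ ≤ ∫⁻ ξ, ENNReal.ofReal (2 * ‖𝓕 (T (f - h)) ξ‖ ^ 2 +
        2 * (t ^ 2)⁻¹ * (‖ξ‖ ^ 2 * ‖𝓕 (T h) ξ‖ ^ 2)) := by
        refine lintegral_mono fun ξ => ENNReal.ofReal_le_ofReal ?_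
        split_ifs with hξ
        · rw [hT, add_apply]
          have n1 := norm_add_le (𝓕 (T (f - h)) ξ) (𝓕 (T h) ξ)
          have n2 : 1 ≤ (t ^ 2)⁻¹ * ‖ξ‖ ^ 2 := by
            rw [inv_mul_eq_div, one_le_div (by positivity)]
            gcongr
          have n3 : 1 * ‖𝓕 (T h) ξ‖ ^ 2 ≤ (t ^ 2)⁻¹ * ‖ξ‖ ^ 2 * ‖𝓕 (T h) ξ‖ ^ 2 := by gcongr
          calc _ ≤ (‖𝓕 (T (f - h)) ξ‖ + ‖𝓕 (T h) ξ‖) ^ 2 := by gcongr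
            _ ≤ _ := by nlinarith [sq_nonneg (‖𝓕 (T (f - h)) ξ‖ - ‖𝓕 (T h) ξ‖)]
        · positivity
    _ = ENNReal.ofReal (∫ ξ, (2 * ‖𝓕 (T (f - h)) ξ‖ ^ 2 +
        2 * (t ^ 2)⁻¹ * (‖ξ‖ ^ 2 * ‖𝓕 (T h) ξ‖ ^ 2))) := by
        symm
        refine ofReal_integral_eq_lintegral_ofReal ((hin1.const_mul _).add (hin2.const_mul _)) ?_
        exact Filter.Eventually.of_forall fun ξ => by positivity
    _ ≤ ENNReal.ofReal (∫ ξ, (2 * ‖𝓕 (f - h) ξ‖ ^ 2 +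
        2 * (t ^ 2)⁻¹ * A * (‖ξ‖ ^ 2 * ‖𝓕 h ξ‖ ^ 2))) := by
        apply ENNReal.ofReal_le_ofReal
        rw [integral_add (hin1.const_mul _) (hin2.const_mul _),
          integral_add (hin3.const_mul _) (hin4.const_mul _), integral_const_mul,
          integral_const_mul, integral_const_mul, integral_const_mul, mul_assoc _ A]
        have := h0 (f - h)
        have := h1 h
        gcongr
    _ = ∫⁻ ξ, ENNReal.ofReal (2 * ‖𝓕 (f - h) ξ‖ ^ 2 +
        2 * (t ^ 2)⁻¹ * A * (‖ξ‖ ^ 2 * ‖𝓕 h ξ‖ ^ 2)) := by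
        refine ofReal_integral_eq_lintegral_ofReal ((hin3.const_mul _).add (hin4.const_mul _)) ?_
        exact Filter.Eventually.of_forall fun ξ => by positivity
    _ ≤ _ := by
        refine lintegral_mono fun ξ => ENNReal.ofReal_le_ofReal ?_
        rw [hF, hFk, norm_smul, norm_smul, K, add_mul, mul_pow, mul_pow, Real.norm_eq_abs,
          Real.norm_eq_abs, sq_abs, sq_abs]
        have c0 := χ.nonneg (x := ξ)
        have c1 := χ.le_one (x := ξ)
        refine add_le_add ?_ ?_
        · rw [← mul_assoc]
          gcongr
          split_ifs with hξ
          · nlinarith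
          · have : χ ξ = 1 := χ.one_of_mem_closedBall (by simpa using (not_le.1 hξ).le)
            simp [this]
        · rw [← mul_assoc, ← mul_assoc]
          gcongr
          split_ifs with hξ
          · have : χ ξ ^ 2 ≤ 1 := pow_le_one₀ c0 c1
            calc _ ≤ 2 * (t ^ 2)⁻¹ * A * ‖ξ‖ ^ 2 * 1 := by gcongr
              _ = _ := by ring
          · have : χ ξ = 0 := χ.zero_of_le_dist (by simpa using (not_le.1 hξ).le)
            simp [this]

lemma interp {A : ℝ} (hA : 0 ≤ A)
    (T : 𝓢(EuclideanSpace ℝ (Fin n), ℂ) →L[ℝ] 𝓢(EuclideanSpace ℝ (Fin n), ℂ))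
    (h0 : ∀ h, ∫ ξ, ‖𝓕 (T h) ξ‖ ^ 2 ≤ ∫ ξ, ‖𝓕 h ξ‖ ^ 2)
    (h1 : ∀ h, ∫ ξ, ‖ξ‖ ^ 2 * ‖𝓕 (T h) ξ‖ ^ 2 ≤ A * ∫ ξ, ‖ξ‖ ^ 2 * ‖𝓕 h ξ‖ ^ 2)
    (f : 𝓢(EuclideanSpace ℝ (Fin n), ℂ)) :
    ∫⁻ ξ, ENNReal.ofReal (‖ξ‖ * ‖𝓕 (T f) ξ‖ ^ 2) ≤
      ENNReal.ofReal ((2 + 4 * A) * ∫ ξ, ‖ξ‖ * ‖𝓕 f ξ‖ ^ 2) := by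
  have cT : Continuous (fun ξ => ‖𝓕 (T f) ξ‖ ^ 2) := (𝓕 (T f)).continuous.norm.pow 2
  have cf : Continuous (fun ξ => ‖𝓕 f ξ‖ ^ 2) := (𝓕 f).continuous.norm.pow 2
  calc _ = ∫⁻ ξ : EuclideanSpace ℝ (Fin n), ∫⁻ t in Ioi (0:ℝ),
        ENNReal.ofReal (if t < ‖ξ‖ then ‖𝓕 (T f) ξ‖ ^ 2 else 0) := by
        refine lintegral_congr fun ξ => ?_
        have : ∀ t, ENNReal.ofReal (if t < ‖ξ‖ then ‖𝓕 (T f) ξ‖ ^ 2 else 0) =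
            (Iio ‖ξ‖).indicator (fun _ => ENNReal.ofReal (‖𝓕 (T f) ξ‖ ^ 2)) t := by
          intro t; by_cases h : t < ‖ξ‖ <;> simp [h]
        simp_rw [this]
        rw [lintegral_indicator measurableSet_Iio, Measure.restrict_restrict measurableSet_Iio,
          Iio_inter_Ioi, setLIntegral_const, Real.volume_Ioo, sub_zero, mul_comm,
          ENNReal.ofReal_mul' (norm_nonneg _)]
    _ = ∫⁻ t in Ioi (0:ℝ), ∫⁻ ξ : EuclideanSpace ℝ (Fin n),
        ENNReal.ofReal (if t < ‖ξ‖ then ‖𝓕 (T f) ξ‖ ^ 2 else 0) := by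
        refine lintegral_lintegral_swap (Measurable.aemeasurable ?_)
        refine ENNReal.measurable_ofReal.comp ?_
        exact Measurable.ite (measurableSet_lt measurable_snd (by fun_prop))
          (cT.measurable.comp measurable_fst) (by fun_prop)
    _ ≤ ∫⁻ t in Ioi (0:ℝ), ∫⁻ ξ : EuclideanSpace ℝ (Fin n),
        ENNReal.ofReal (K A t ‖ξ‖ * ‖𝓕 f ξ‖ ^ 2) :=
        setLIntegral_mono' measurableSet_Ioi fun t ht => step hA T h0 h1 f ht
    _ = ∫⁻ ξ : EuclideanSpace ℝ (Fin n), ∫⁻ t in Ioi (0:ℝ),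
        ENNReal.ofReal (K A t ‖ξ‖ * ‖𝓕 f ξ‖ ^ 2) := by
        refine lintegral_lintegral_swap (Measurable.aemeasurable ?_)
        refine ENNReal.measurable_ofReal.comp ?_
        refine Measurable.mul ?_ (cf.measurable.comp measurable_snd)
        exact (K_meas A).comp (measurable_fst.prodMk measurable_snd.norm)
    _ ≤ ∫⁻ ξ : EuclideanSpace ℝ (Fin n),
        ENNReal.ofReal ((2 + 4 * A) * (‖ξ‖ * ‖𝓕 f ξ‖ ^ 2)) := by
        refine lintegral_mono fun ξ => ?_
        simp_rw [fun t => ENNReal.ofReal_mul (q := ‖𝓕 f ξ‖ ^ 2) (K_nonneg hA t ‖ξ‖)]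
        have hm : Measurable fun t => ENNReal.ofReal (K A t ‖ξ‖) := ENNReal.measurable_ofReal.comp
          ((K_meas A).comp (measurable_id.prodMk measurable_const))
        rw [lintegral_mul_const _ hm, ← mul_assoc,
          ENNReal.ofReal_mul (by positivity)]
        gcongr
        exact K_int hA (norm_nonneg _)
    _ = _ := by
        have := (int_norm_sq 1 (𝓕 f)).const_mul (2 + 4 * A)
        simp only [pow_one] at this
        rw [← integral_const_mul, ofReal_integral_eq_lintegral_ofReal this]
        exact Filter.Eventually.of_forall fun ξ => by positivity

end HalfSob
namespace HalfSob

variable {n : ℕ}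

open Set Filter Topology

lemma m_abs_le {a : ℝ} (ha : 0 < a) (x : EuclideanSpace ℝ (Fin n)) (i : Fin n) :
    |x i * R a x| ≤ 1 := by
  rw [← sq_le_one_iff_abs_le_one, mul_pow]
  have := R_sq_le ha x
  have := mul_le_mul_of_nonneg_right (sq_coord_le x i) (sq_nonneg (R a x))
  linarith

lemma m_tendsto (x : EuclideanSpace ℝ (Fin n)) (i : Fin n) :
    Tendsto (fun k : ℕ => x i * R ((k:ℝ) + 1) x) atTop (𝓝 (x i / ‖x‖)) := by
  by_cases hx : x = 0
  · simp [hx]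
  have hx' : 0 < ‖x‖ := norm_pos_iff.2 hx
  have hR : ∀ k : ℕ, R ((k:ℝ) + 1) x = (√((1 / ((k:ℝ) + 1)) ^ 2 + ‖x‖ ^ 2))⁻¹ := by
    intro k
    have hk : (0:ℝ) < (k:ℝ) + 1 := by positivity
    have h1 := R_sq hk x
    rw [← Real.sqrt_inv, eq_comm, Real.sqrt_eq_iff_mul_self_eq (by positivity) (R_nonneg hk x), ← sq]
    rw [div_pow, one_pow]
    exact (eq_inv_of_mul_eq_one_left h1).symm
  simp_rw [hR, div_eq_mul_inv (x i)]
  refine Tendsto.const_mul _ ?_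
  have h2 : Tendsto (fun k : ℕ => √((1 / ((k:ℝ) + 1)) ^ 2 + ‖x‖ ^ 2)) atTop (𝓝 (√(0 ^ 2 + ‖x‖ ^ 2))) :=
    ((tendsto_one_div_add_atTop_nhds_zero_nat.pow 2).add_const _).sqrt
  have h3 : √(0 ^ 2 + ‖x‖ ^ 2) = ‖x‖ := by simp
  rw [h3] at h2
  exact h2.inv₀ hx'.ne'

/-- The approximating operator. -/
noncomputable def TT (k : ℕ) (i : Fin n) :
    𝓢(EuclideanSpace ℝ (Fin n), ℂ) →L[ℝ] 𝓢(EuclideanSpace ℝ (Fin n), ℂ) :=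
  SchwartzMap.smulLeftCLM ℂ (fun x : EuclideanSpace ℝ (Fin n) => x i * R ((k:ℝ) + 1) x)

lemma TT_apply (k : ℕ) (i : Fin n) (f : 𝓢(EuclideanSpace ℝ (Fin n), ℂ)) (x) :
    TT k i f x = (x i * R ((k:ℝ) + 1) x) • f x :=
  SchwartzMap.smulLeftCLM_apply_apply (m_temp _ i) f x

/-- Components of the vector-valued operator. -/
noncomputable def G (f : 𝓢(EuclideanSpace ℝ (Fin n), ℂ)) (i : Fin n)
    (x : EuclideanSpace ℝ (Fin n)) : ℂ := ((x i / ‖x‖ : ℝ) : ℂ) * f x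

lemma G_int (f : 𝓢(EuclideanSpace ℝ (Fin n), ℂ)) (i : Fin n) : Integrable (G f i) := by
  have hm : Measurable (G f i) := by
    unfold G
    have h1 : Measurable (fun x : EuclideanSpace ℝ (Fin n) => x i / ‖x‖) :=
      (coord_temp i).1.continuous.measurable.div measurable_norm
    exact (Complex.measurable_ofReal.comp h1).mul f.continuous.measurable
  refine f.integrable.norm.mono' hm.aestronglyMeasurable (Eventually.of_forall fun x => ?_)
  unfold G
  rw [norm_mul, Complex.norm_real]
  refine mul_le_of_le_one_left (norm_nonneg _) ?_
  rw [norm_div, norm_norm]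
  exact div_le_one_of_le₀ (PiLp.norm_apply_le x i) (norm_nonneg _)

lemma F_tendsto (f : 𝓢(EuclideanSpace ℝ (Fin n), ℂ)) (i : Fin n) (ξ : EuclideanSpace ℝ (Fin n)) :
    Tendsto (fun k : ℕ => 𝓕 (TT k i f) ξ) atTop (𝓝 (𝓕 (G f i) ξ)) := by
  simp_rw [SchwartzMap.fourier_coe, Real.fourier_eq]
  refine tendsto_integral_of_dominated_convergence (fun x => ‖f x‖) ?_ f.integrable.norm ?_ ?_
  · intro k
    exact ((Real.fourierIntegral_convergent_iff ξ).2 (TT k i f).integrable).aestronglyMeasurable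
  · intro k
    refine Eventually.of_forall fun x => ?_
    rw [Circle.norm_smul, TT_apply, norm_smul]
    exact mul_le_of_le_one_left (norm_nonneg _) (m_abs_le (by positivity) x i)
  · refine Eventually.of_forall fun x => ?_
    refine Tendsto.const_smul ?_ _
    simp_rw [TT_apply]
    have := (m_tendsto x i).smul_const (f x)
    simpa [G, Complex.real_smul] using this

lemma comp_bound (hn : 3 ≤ n) (f : 𝓢(EuclideanSpace ℝ (Fin n), ℂ)) (i : Fin n) :
    ∫⁻ ξ, ENNReal.ofReal (‖ξ‖ * ‖𝓕 (G f i) ξ‖ ^ 2) ≤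
      ENNReal.ofReal ((2 + 4 * (2 + 32 * n)) * ∫ ξ, ‖ξ‖ * ‖𝓕 f ξ‖ ^ 2) := by
  have h1 : ∀ k : ℕ, ∫⁻ ξ, ENNReal.ofReal (‖ξ‖ * ‖𝓕 (TT k i f) ξ‖ ^ 2) ≤
      ENNReal.ofReal ((2 + 4 * (2 + 32 * n)) * ∫ ξ, ‖ξ‖ * ‖𝓕 f ξ‖ ^ 2) := fun k =>
    interp (by positivity) (TT k i) (fun h => l2bound (by positivity) h i)
      (fun h => h1bound hn (by positivity) h i) f
  calc _ = ∫⁻ ξ, liminf (fun k : ℕ => ENNReal.ofReal (‖ξ‖ * ‖𝓕 (TT k i f) ξ‖ ^ 2)) atTop := by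
        refine lintegral_congr fun ξ => ?_
        symm
        apply Tendsto.liminf_eq
        exact ENNReal.tendsto_ofReal (((F_tendsto f i ξ).norm.pow 2).const_mul _)
    _ ≤ liminf (fun k : ℕ => ∫⁻ ξ, ENNReal.ofReal (‖ξ‖ * ‖𝓕 (TT k i f) ξ‖ ^ 2)) atTop := by
        refine lintegral_liminf_le fun k => ENNReal.measurable_ofReal.comp ?_
        exact (continuous_norm.mul ((𝓕 (TT k i f)).continuous.norm.pow 2)).measurable
    _ ≤ _ := by
        refine (liminf_le_liminf (Eventually.of_forall h1)).trans ?_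
        simp

lemma F_comp (f : 𝓢(EuclideanSpace ℝ (Fin n), ℂ)) (ξ : EuclideanSpace ℝ (Fin n)) (i : Fin n) :
    (𝓕 (fun x : EuclideanSpace ℝ (Fin n) =>
      ((EuclideanSpace.equiv (Fin n) ℂ).symm (fun i => ((x i / ‖x‖ : ℝ) : ℂ) * f x))) ξ) i
      = 𝓕 (G f i) ξ := by
  have hint : Integrable (fun x : EuclideanSpace ℝ (Fin n) =>
      ((EuclideanSpace.equiv (Fin n) ℂ).symm (fun i => ((x i / ‖x‖ : ℝ) : ℂ) * f x))) := by
    have h1 : Integrable (fun x : EuclideanSpace ℝ (Fin n) =>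
      (fun i => ((x i / ‖x‖ : ℝ) : ℂ) * f x)) := Integrable.of_eval fun i => G_int f i
    exact ((EuclideanSpace.equiv (Fin n) ℂ).symm : _ →L[ℂ] EuclideanSpace ℂ (Fin n)).integrable_comp h1
  have h2 := (Real.fourierIntegral_convergent_iff ξ).2 hint
  rw [Real.fourier_eq, Real.fourier_eq]
  exact ((EuclideanSpace.proj (𝕜 := ℂ) i : EuclideanSpace ℂ (Fin n) →L[ℂ] ℂ).integral_comp_comm h2).symm

end HalfSob

/-- The operator `T f (x) = (x/|x|) f(x)` is bounded on `Ḣ^{1/2}(ℝⁿ)`, `n ≥ 3`,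
where the `Ḣ^{1/2}` norm squared is `∫ |ξ| ‖𝓕f(ξ)‖² dξ` (also for vector-valued `Tf`). -/
theorem stmt1 (n : ℕ) (hn : 3 ≤ n) :
    ∃ C > 0, ∀ f : SchwartzMap (EuclideanSpace ℝ (Fin n)) ℂ,
      (∫ ξ : EuclideanSpace ℝ (Fin n), ‖ξ‖ *
          ‖𝓕 (fun x : EuclideanSpace ℝ (Fin n) =>
              ((EuclideanSpace.equiv (Fin n) ℂ).symm
                (fun i => ((x i / ‖x‖ : ℝ) : ℂ) * f x))) ξ‖ ^ 2) ≤
        C * ∫ ξ : EuclideanSpace ℝ (Fin n), ‖ξ‖ * ‖𝓕 (⇑f) ξ‖ ^ 2 := by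
  refine ⟨n * (2 + 4 * (2 + 32 * n)), by positivity, fun f => ?_⟩
  simp_rw [EuclideanSpace.norm_sq_eq, HalfSob.F_comp, Finset.mul_sum]
  have hI : 0 ≤ ∫ ξ : EuclideanSpace ℝ (Fin n), ‖ξ‖ * ‖𝓕 (⇑f) ξ‖ ^ 2 :=
    integral_nonneg fun ξ => by positivity
  have hcont : ∀ i, Continuous (𝓕 (HalfSob.G f i)) := fun i =>
    VectorFourier.fourierIntegral_continuous Real.continuous_fourierChar
      (by exact continuous_inner) (HalfSob.G_int f i)
  have hmeas : ∀ i, Continuous fun ξ : EuclideanSpace ℝ (Fin n) => ‖ξ‖ * ‖𝓕 (HalfSob.G f i) ξ‖ ^ 2 :=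
    fun i => continuous_norm.mul ((hcont i).norm.pow 2)
  have hi : ∀ i, Integrable fun ξ : EuclideanSpace ℝ (Fin n) => ‖ξ‖ * ‖𝓕 (HalfSob.G f i) ξ‖ ^ 2 := by
    intro i
    refine ⟨(hmeas i).aestronglyMeasurable, ?_⟩
    rw [hasFiniteIntegral_iff_ofReal (Filter.Eventually.of_forall fun ξ => by positivity)]
    exact (HalfSob.comp_bound hn f i).trans_lt ENNReal.ofReal_lt_top
  have hb : ∀ i, ∫ ξ : EuclideanSpace ℝ (Fin n), ‖ξ‖ * ‖𝓕 (HalfSob.G f i) ξ‖ ^ 2 ≤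
      (2 + 4 * (2 + 32 * n)) * ∫ ξ : EuclideanSpace ℝ (Fin n), ‖ξ‖ * ‖𝓕 (⇑f) ξ‖ ^ 2 := by
    intro i
    rw [integral_eq_lintegral_of_nonneg_ae (Filter.Eventually.of_forall fun ξ => by positivity)
      (hmeas i).aestronglyMeasurable]
    exact ENNReal.toReal_le_of_le_ofReal (by positivity) (HalfSob.comp_bound hn f i)
  rw [integral_finsetSum _ fun i _ => hi i]
  refine (Finset.sum_le_sum fun i _ => hb i).trans (le_of_eq ?_)
  simp
  ring
end
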